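/- arXiv:1109.0699 — 2 statements merged into one kernel-verified Lean document; each statement's English description precedes it below -/
import Mathlib

section
/- Assume S is infinite. Let T be a set of L-sentences and φ an L-formula with free variables among x₁,…,xₙ. Every open subset of D_φ that is stable under the action θ is a union of subsets of the form {(M,m) ∈ D_φ : ∃y₁…∃y_m ψ is satisfied in M under xᵢ ↦ mᵢ}, where ψ ranges over Horn formulas with free variables among x₁,…,xₙ,y₁,…,y_m. -/
open FirstOrder Language Set Topology TopologicalSpace Cardinal

universe u v w

namespace SemGpd

variable (L : FirstOrder.Language.{u, v}) (S : Type w)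

/-- An `S`-indexed `L`-structure: a subset `A ⊆ S`, an equivalence relation `≈` on `A`,
and an `L`-structure on the quotient `A/≈`. -/
structure IndexedStructure where
  A : Set S
  r : Setoid A
  str : L.Structure (Quotient r)

variable {L S}

/-- The underlying set (carrier) `A/≈` of an indexed structure. -/
abbrev IndexedStructure.carrier (M : IndexedStructure L S) : Type w := Quotient M.r

/-- The equivalence class of an indexed element. -/
def IndexedStructure.cls (M : IndexedStructure L S) (a : S) (h : a ∈ M.A) : M.carrier :=
  Quotient.mk M.r ⟨a, h⟩

/-- Satisfaction of a formula in an indexed structure under an assignment. -/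
def IndexedStructure.Sat (M : IndexedStructure L S) {α : Type*} (φ : L.Formula α)
    (v : α → M.carrier) : Prop :=
  letI := M.str
  φ.Realize v

/-- Satisfaction of a sentence in an indexed structure. -/
def IndexedStructure.SatSentence (M : IndexedStructure L S) (σ : L.Sentence) : Prop :=
  letI := M.str
  M.carrier ⊨ σ

/-- `M` is an `S`-indexed model of the theory `T`. -/
def IndexedStructure.models (M : IndexedStructure L S) (T : Set L.Sentence) : Prop :=
  ∀ σ ∈ T, M.SatSentence σ

variable (L S)

/-- The basic set `⟨φ, a⟩` of indexed structures. -/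
def fSet {n : ℕ} (φ : L.Formula (Fin n)) (a : Fin n → S) : Set (IndexedStructure L S) :=
  {M | ∃ h : ∀ i, a i ∈ M.A, M.Sat φ fun i => M.cls (a i) (h i)}

/-- The basic set `⟨a⟩` of structures in which `a` is indexed. -/
def membSet (a : S) : Set (IndexedStructure L S) :=
  {M | a ∈ M.A}

/-- The logical topology on the space of `S`-indexed `L`-structures, generated by the
membership conditions `⟨a⟩` and the atomic conditions `⟨φ, a⟩` for `φ` atomic (which include
the relation conditions `⟨R,a⟩`, the function conditions `⟨f(a)=b⟩` and equality conditions). -/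
def logicalTopology : TopologicalSpace (IndexedStructure L S) :=
  generateFrom {U | (∃ a : S, U = membSet L S a) ∨
    ∃ (n : ℕ) (φ : L.Formula (Fin n)), BoundedFormula.IsAtomic φ ∧
      ∃ a : Fin n → S, U = fSet L S φ a}

instance : TopologicalSpace (IndexedStructure L S) := logicalTopology L S

/-- An isomorphism between `S`-indexed `L`-structures. -/
structure IndexedIso where
  dom : IndexedStructure L S
  cod : IndexedStructure L S
  iso : @Language.Equiv L dom.carrier cod.carrier dom.str cod.str

variable {L S}

/-- Application of an isomorphism of indexed structures to an element of the domain. -/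
def IndexedIso.map (F : IndexedIso L S) (x : F.dom.carrier) : F.cod.carrier :=
  (@Language.Equiv.toEquiv L F.dom.carrier F.cod.carrier F.dom.str F.cod.str F.iso) x

/-- The basic set `⟨a ↦ b⟩` of isomorphisms. -/
def mapSet (a b : S) : Set (IndexedIso L S) :=
  {F | ∃ (ha : a ∈ F.dom.A) (hb : b ∈ F.cod.A),
    F.map (F.dom.cls a ha) = F.cod.cls b hb}

variable (L S)

/-- The logical topology on the space of isomorphisms of `S`-indexed `L`-structures:
the coarsest topology making `dom` and `cod` continuous and containing each `⟨a ↦ b⟩`. -/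
def isoTopology : TopologicalSpace (IndexedIso L S) :=
  ((logicalTopology L S).induced IndexedIso.dom) ⊓
    ((logicalTopology L S).induced IndexedIso.cod) ⊓
    generateFrom {V | ∃ a b : S, V = mapSet a b}

instance : TopologicalSpace (IndexedIso L S) := isoTopology L S

variable {L S}

/-- The identity isomorphism. -/
def idIso (M : IndexedStructure L S) : IndexedIso L S :=
  ⟨M, M, by letI := M.str; exact Language.Equiv.refl L M.carrier⟩

/-- The inverse of an isomorphism of indexed structures. -/
def IndexedIso.inv (F : IndexedIso L S) : IndexedIso L S :=
  ⟨F.cod, F.dom, by letI := F.dom.str; letI := F.cod.str; exact F.iso.symm⟩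

/-- The composite of two composable isomorphisms of indexed structures. -/
def IndexedIso.comp (F G : IndexedIso L S) (h : F.cod = G.dom) : IndexedIso L S :=
  ⟨F.dom, G.cod, by
    letI := F.dom.str; letI := F.cod.str; letI := G.cod.str
    exact Language.Equiv.comp (by rw [h]; exact G.iso) F.iso⟩

variable (L S)

/-- The space of composable pairs of isomorphisms, as a subspace of the product. -/
def CompPairs := {p : IndexedIso L S × IndexedIso L S // p.1.cod = p.2.dom}

instance : TopologicalSpace (CompPairs L S) :=
  instTopologicalSpaceSubtype

/-- The space `M_T` of `S`-indexed models of `T`, as a subspace of `M_L`. -/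
abbrev ModelsT (T : Set L.Sentence) := {M : IndexedStructure L S // M.models T}

/-- The space `I_T` of isomorphisms between `S`-indexed models of `T`, as a subspace of `I_L`. -/
abbrev IsoT (T : Set L.Sentence) := {F : IndexedIso L S // F.dom.models T ∧ F.cod.models T}

variable {L S}

/-- The domain map `d : I_T → M_T`. -/
def IsoT.d {T : Set L.Sentence} (F : IsoT L S T) : ModelsT L S T := ⟨F.1.dom, F.2.1⟩

/-- The codomain map `c : I_T → M_T`. -/
def IsoT.c {T : Set L.Sentence} (F : IsoT L S T) : ModelsT L S T := ⟨F.1.cod, F.2.2⟩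

/-- Horn formulas: finite conjunctions of atomic formulas (including `⊤`). -/
inductive IsHorn {α : Type*} : ∀ {n : ℕ}, L.BoundedFormula α n → Prop
  | top {n : ℕ} : IsHorn (⊤ : L.BoundedFormula α n)
  | equal {n : ℕ} (t₁ t₂ : L.Term (α ⊕ Fin n)) : IsHorn (t₁.bdEqual t₂)
  | rel {n k : ℕ} (R : L.Relations k) (ts : Fin k → L.Term (α ⊕ Fin n)) :
      IsHorn (R.boundedFormula ts)
  | inf {n : ℕ} {φ ψ : L.BoundedFormula α n} : IsHorn φ → IsHorn ψ → IsHorn (φ ⊓ ψ)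

/-- Coherent formulas: built from atomic formulas, `⊤` and `⊥` by `∧`, `∨` and `∃`. -/
inductive IsCoherent {α : Type*} : ∀ {n : ℕ}, L.BoundedFormula α n → Prop
  | falsum {n : ℕ} : IsCoherent (⊥ : L.BoundedFormula α n)
  | top {n : ℕ} : IsCoherent (⊤ : L.BoundedFormula α n)
  | equal {n : ℕ} (t₁ t₂ : L.Term (α ⊕ Fin n)) : IsCoherent (t₁.bdEqual t₂)
  | rel {n k : ℕ} (R : L.Relations k) (ts : Fin k → L.Term (α ⊕ Fin n)) :
      IsCoherent (R.boundedFormula ts)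
  | inf {n : ℕ} {φ ψ : L.BoundedFormula α n} : IsCoherent φ → IsCoherent ψ → IsCoherent (φ ⊓ ψ)
  | sup {n : ℕ} {φ ψ : L.BoundedFormula α n} : IsCoherent φ → IsCoherent ψ → IsCoherent (φ ⊔ ψ)
  | ex {n : ℕ} {φ : L.BoundedFormula α (n + 1)} : IsCoherent φ → IsCoherent φ.ex

/-- A coherent sequent: a sentence of the form `∀ x₁ … xₙ (φ → ψ)` with `φ, ψ` coherent. -/
def IsCoherentSequent (σ : L.Sentence) : Prop :=
  ∃ (n : ℕ) (φ ψ : L.BoundedFormula Empty n),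
    IsCoherent φ ∧ IsCoherent ψ ∧ σ = (φ.imp ψ).alls


variable (L S)

/-- The sheaf `D_φ` of realizations of `φ` over the space of `S`-indexed models of `T`. -/
structure DSet (T : Set L.Sentence) {n : ℕ} (φ : L.Formula (Fin n)) where
  str : IndexedStructure L S
  mods : str.models T
  tup : Fin n → str.carrier
  sat : str.Sat φ tup

variable {L S}

/-- The projection `π₁ : D_φ → M_T`. -/
def DSet.pi {T : Set L.Sentence} {n : ℕ} {φ : L.Formula (Fin n)} (d : DSet L S T φ) :
    ModelsT L S T := ⟨d.str, d.mods⟩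

variable (L S)

/-- The image of the section `s_a : ⟨φ,a⟩ ∩ M_T → D_φ`. -/
def secImage (T : Set L.Sentence) {n : ℕ} (φ : L.Formula (Fin n)) (a : Fin n → S) :
    Set (DSet L S T φ) :=
  {d | ∃ h : ∀ i, a i ∈ d.str.A, d.tup = fun i => d.str.cls (a i) (h i)}

/-- The logical topology on `D_φ`: the coarsest topology making `π₁` continuous and making the
image of every section `s_a` open. -/
def dTopology (T : Set L.Sentence) {n : ℕ} (φ : L.Formula (Fin n)) :
    TopologicalSpace (DSet L S T φ) :=
  (TopologicalSpace.induced DSet.pi inferInstance) ⊓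
    generateFrom {V | ∃ a : Fin n → S, V = secImage L S T φ a}

instance {T : Set L.Sentence} {n : ℕ} {φ : L.Formula (Fin n)} :
    TopologicalSpace (DSet L S T φ) := dTopology L S T φ

/-- The basic open set `⟨ψ, b⟩` of `D_φ`. -/
def dBasic (T : Set L.Sentence) {n : ℕ} (φ : L.Formula (Fin n)) {m : ℕ}
    (ψ : L.Formula (Fin n ⊕ Fin m)) (b : Fin m → S) : Set (DSet L S T φ) :=
  {d | ∃ h : ∀ j, b j ∈ d.str.A,
    d.str.Sat ψ (Sum.elim d.tup fun j => d.str.cls (b j) (h j))}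

/-- The fiber product `I_T ×_{M_T} D_φ` of composable pairs for the application action. -/
def ActPairs (T : Set L.Sentence) {n : ℕ} (φ : L.Formula (Fin n)) :=
  {p : IsoT L S T × DSet L S T φ // p.1.1.dom = p.2.str}

instance {T : Set L.Sentence} {n : ℕ} {φ : L.Formula (Fin n)} :
    TopologicalSpace (ActPairs L S T φ) := instTopologicalSpaceSubtype

variable {L S}

/-- Isomorphisms of indexed structures preserve satisfaction. -/
theorem IndexedIso.sat_map (F : IndexedIso L S) {α : Type*} (φ : L.Formula α)
    (v : α → F.dom.carrier) (h : F.dom.Sat φ v) :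
    F.cod.Sat φ fun i => F.map (v i) := by
  letI := F.dom.str
  letI := F.cod.str
  have := (StrongHomClass.realize_formula (F.iso) φ (v := v)).mpr h
  exact this

/-- Transport of satisfaction along an equality of indexed structures. -/
theorem sat_cast {M N : IndexedStructure L S} (h : M = N) {α : Type*} (φ : L.Formula α)
    (v : α → N.carrier) (hs : N.Sat φ v) :
    M.Sat φ fun i => cast (congrArg IndexedStructure.carrier h.symm) (v i) := by
  subst h; exact hs

/-- The application action `θ : I_T ×_{M_T} D_φ → D_φ`. -/
def act {T : Set L.Sentence} {n : ℕ} {φ : L.Formula (Fin n)} (p : ActPairs L S T φ) :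
    DSet L S T φ where
  str := p.1.1.1.cod
  mods := p.1.1.2.2
  tup := fun i =>
    p.1.1.1.map (cast (congrArg IndexedStructure.carrier p.2.symm) (p.1.2.tup i))
  sat := p.1.1.1.sat_map φ _ (sat_cast p.2 φ p.1.2.tup p.1.2.sat)

/-- A subset of `D_φ` is stable if it is closed under the application action. -/
def Stable {T : Set L.Sentence} {n : ℕ} {φ : L.Formula (Fin n)}
    (X : Set (DSet L S T φ)) : Prop :=
  ∀ p : ActPairs L S T φ, p.1.2 ∈ X → act p ∈ X

/-- The stabilization of a subset of `D_φ`: the smallest stable subset containing it. -/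
def stabilization {T : Set L.Sentence} {n : ℕ} {φ : L.Formula (Fin n)}
    (X : Set (DSet L S T φ)) : Set (DSet L S T φ) :=
  ⋂₀ {Y | X ⊆ Y ∧ Stable Y}

/-- The set `{(M,m) ∈ D_φ : M ⊨ ∃y ψ(m,y)}`. -/
def exSet {T : Set L.Sentence} {n : ℕ} (φ : L.Formula (Fin n)) {m : ℕ}
    (ψ : L.Formula (Fin n ⊕ Fin m)) : Set (DSet L S T φ) :=
  {d | ∃ w : Fin m → d.str.carrier, d.str.Sat ψ (Sum.elim d.tup w)}

/-- The identity isomorphism on a model of `T`, as an element of `I_T`. -/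
def idIsoT {T : Set L.Sentence} (M : ModelsT L S T) : IsoT L S T :=
  ⟨idIso M.1, M.2, M.2⟩

/-- The inverse, in `I_T`. -/
def IsoT.inv {T : Set L.Sentence} (F : IsoT L S T) : IsoT L S T :=
  ⟨F.1.inv, F.2.2, F.2.1⟩

/-- The composite, in `I_T`. -/
def IsoT.comp {T : Set L.Sentence} (F G : IsoT L S T) (h : F.1.cod = G.1.dom) : IsoT L S T :=
  ⟨F.1.comp G.1 h, F.2.1, G.2.2⟩



section HornFormulas

variable {L : FirstOrder.Language.{u, v}} {S : Type w}

theorem _root_.FirstOrder.Language.BoundedFormula.IsAtomic.isHorn {α : Type*} {n : ℕ}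
    {φ : L.BoundedFormula α n} (h : φ.IsAtomic) : IsHorn φ := by
  cases h with
  | equal t₁ t₂ => exact .equal t₁ t₂
  | rel R ts => exact .rel R ts

theorem IsHorn.relabel {α β : Type*} {n k : ℕ} {φ : L.BoundedFormula α n} (h : IsHorn φ)
    (g : α → β ⊕ Fin k) : IsHorn (φ.relabel g) := by
  induction h with
  | top => exact .top
  | equal t₁ t₂ => exact .equal _ _
  | rel R ts => exact .rel _ _
  | inf _ _ ih₁ ih₂ => exact .inf ih₁ ih₂

theorem IsHorn.formula_relabel {α β : Type*} {φ : L.Formula α} (h : IsHorn φ) (g : α → β) :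
    IsHorn (Formula.relabel g φ) :=
  IsHorn.relabel h _

theorem sat_relabel (M : IndexedStructure L S) {α β : Type*} (φ : L.Formula α) (g : α → β)
    (v : β → M.carrier) : M.Sat (φ.relabel g) v ↔ M.Sat φ (v ∘ g) :=
  let := M.str
  Formula.realize_relabel

theorem sat_inf (M : IndexedStructure L S) {α : Type*} (φ ψ : L.Formula α)
    (v : α → M.carrier) : M.Sat (φ ⊓ ψ) v ↔ M.Sat φ v ∧ M.Sat ψ v :=
  let := M.str
  Formula.realize_inf

theorem sat_top (M : IndexedStructure L S) {α : Type*} (v : α → M.carrier) :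
    M.Sat (⊤ : L.Formula α) v :=
  let := M.str
  Formula.realize_top.2 trivial

theorem sat_equal_var (M : IndexedStructure L S) {α : Type*} (i j : α) (v : α → M.carrier) :
    M.Sat (Term.equal (L := L) (Term.var i) (Term.var j)) v ↔ v i = v j :=
  let := M.str
  Formula.realize_equal

end HornFormulas

section HornTopology

variable {L : FirstOrder.Language.{u, v}} {S : Type w} {T : Set L.Sentence} {n : ℕ}
  {φ : L.Formula (Fin n)}

/-- The set of `(M, m)` such that the parameters `s ∈ F` are indexed in `M` and, together with
`m`, satisfy `ψ`. -/
def paramBasic (T : Set L.Sentence) (φ : L.Formula (Fin n)) (F : Finset S)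
    (ψ : L.Formula (Fin n ⊕ F)) : Set (DSet L S T φ) :=
  {d | ∃ h : ∀ s : F, s.1 ∈ d.str.A,
    d.str.Sat ψ (Sum.elim d.tup fun s => d.str.cls s.1 (h s))}

theorem paramBasic_relabel {F G : Finset S} (hFG : F ⊆ G) (ψ : L.Formula (Fin n ⊕ F))
    {d : DSet L S T φ} (h : ∀ s : G, s.1 ∈ d.str.A) :
    d.str.Sat (ψ.relabel (Sum.map id (Set.inclusion hFG)))
        (Sum.elim d.tup fun s => d.str.cls s.1 (h s)) ↔ d ∈ paramBasic T φ F ψ := by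
  rw [sat_relabel, Sum.elim_comp_map]
  exact ⟨fun hd => ⟨fun s => h (Set.inclusion hFG s), hd⟩, fun ⟨_, hd⟩ => hd⟩

/-- The topology whose basic open sets are the `paramBasic` sets of Horn formulas. -/
def hornTopology (T : Set L.Sentence) (φ : L.Formula (Fin n)) :
    TopologicalSpace (DSet L S T φ) where
  IsOpen W := ∀ d ∈ W, ∃ (F : Finset S) (ψ : L.Formula (Fin n ⊕ F)),
    IsHorn ψ ∧ d ∈ paramBasic T φ F ψ ∧ paramBasic T φ F ψ ⊆ W
  isOpen_univ d _ := ⟨∅, ⊤, .top, ⟨fun s => absurd s.2 (Finset.notMem_empty _), sat_top _ _⟩,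
    subset_univ _⟩
  isOpen_inter V W hV hW d hd := by
    classical
    obtain ⟨F, ψ, hψ, hdF, hFV⟩ := hV d hd.1
    obtain ⟨G, χ, hχ, hdG, hGW⟩ := hW d hd.2
    refine ⟨F ∪ G, ψ.relabel (Sum.map id (Set.inclusion Finset.subset_union_left)) ⊓
      χ.relabel (Sum.map id (Set.inclusion Finset.subset_union_right)),
      .inf (hψ.formula_relabel _) (hχ.formula_relabel _), ?_, ?_⟩
    · have h : ∀ s : (F ∪ G : Finset S), s.1 ∈ d.str.A := fun s =>
        (Finset.mem_union.1 s.2).elim (fun hs => hdF.1 ⟨s, hs⟩) fun hs => hdG.1 ⟨s, hs⟩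
      exact ⟨h, (sat_inf _ _ _ _).2
        ⟨(paramBasic_relabel _ _ h).2 hdF, (paramBasic_relabel _ _ h).2 hdG⟩⟩
    · rintro e ⟨h, he⟩
      obtain ⟨he₁, he₂⟩ := (sat_inf _ _ _ _).1 he
      exact ⟨hFV ((paramBasic_relabel _ _ h).1 he₁), hGW ((paramBasic_relabel _ _ h).1 he₂)⟩
  isOpen_sUnion 𝒲 h𝒲 d := by
    rintro ⟨W, hW, hd⟩
    obtain ⟨F, ψ, hψ, hdF, hFW⟩ := h𝒲 W hW d hd
    exact ⟨F, ψ, hψ, hdF, hFW.trans (subset_sUnion_of_mem hW)⟩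

theorem isOpen_hornTopology_paramBasic {F : Finset S} {ψ : L.Formula (Fin n ⊕ F)}
    (hψ : IsHorn ψ) : IsOpen[hornTopology T φ] (paramBasic T φ F ψ) :=
  fun _ hd => ⟨F, ψ, hψ, hd, Subset.rfl⟩

theorem isOpen_hornTopology_membSet (a : S) :
    IsOpen[hornTopology T φ] {d : DSet L S T φ | a ∈ d.str.A} := by
  convert isOpen_hornTopology_paramBasic (T := T) (φ := φ) (F := {a}) (ψ := ⊤) .top using 1
  ext d
  refine ⟨fun h => ⟨fun s => ?_, sat_top _ _⟩, fun h => h.1 ⟨a, Finset.mem_singleton_self a⟩⟩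
  rw [Finset.mem_singleton.1 s.2]
  exact h

theorem isOpen_hornTopology_fSet {k : ℕ} {χ : L.Formula (Fin k)} (hχ : IsHorn χ)
    (a : Fin k → S) :
    IsOpen[hornTopology T φ] {d : DSet L S T φ | d.str ∈ fSet L S χ a} := by
  classical
  let g : Fin k → (Finset.univ.image a : Finset S) := fun i =>
    ⟨a i, Finset.mem_image_of_mem a (Finset.mem_univ i)⟩
  convert isOpen_hornTopology_paramBasic (T := T) (φ := φ)
    (hχ.formula_relabel (Sum.inr ∘ g)) using 1
  ext d
  have key (h : ∀ s : (Finset.univ.image a : Finset S), s.1 ∈ d.str.A) :=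
    sat_relabel d.str χ (Sum.inr ∘ g) (Sum.elim d.tup fun s => d.str.cls s.1 (h s))
  constructor
  · rintro ⟨h, hd⟩
    have h' : ∀ s : (Finset.univ.image a : Finset S), s.1 ∈ d.str.A := by
      rintro ⟨s, hs⟩
      obtain ⟨i, -, rfl⟩ := Finset.mem_image.1 hs
      exact h i
    exact ⟨h', (key h').2 hd⟩
  · rintro ⟨h, hd⟩
    exact ⟨fun i => h (g i), (key h).1 hd⟩

theorem isOpen_hornTopology_secImage (a : Fin n → S) :
    IsOpen[hornTopology T φ] (secImage L S T φ a) := by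
  let := hornTopology (S := S) T φ
  have hsec : secImage L S T φ a =
      ⋂ i, {d : DSet L S T φ | ∃ h : a i ∈ d.str.A, d.tup i = d.str.cls (a i) h} := by
    ext d
    simp only [secImage, mem_iInter, mem_ofPred_eq, funext_iff]
    exact ⟨fun ⟨h, hd⟩ i => ⟨h i, hd i⟩, fun h => ⟨fun i => (h i).1, fun i => (h i).2⟩⟩
  rw [hsec]
  refine isOpen_iInter_of_finite fun i => ?_
  let s₀ : ({a i} : Finset S) := ⟨a i, Finset.mem_singleton_self _⟩
  convert isOpen_hornTopology_paramBasic (T := T) (φ := φ) (F := {a i})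
    (ψ := Term.equal (Term.var (Sum.inl i)) (Term.var (Sum.inr s₀))) (.equal _ _) using 1
  ext d
  constructor
  · rintro ⟨h, hd⟩
    have h' : ∀ s : ({a i} : Finset S), s.1 ∈ d.str.A := by
      rintro ⟨s, hs⟩
      obtain rfl := Finset.mem_singleton.1 hs
      exact h
    exact ⟨h', (sat_equal_var _ _ _ _).2 hd⟩
  · rintro ⟨h, hd⟩
    exact ⟨h s₀, (sat_equal_var _ _ _ _).1 hd⟩

theorem hornTopology_le : hornTopology T φ ≤ dTopology L S T φ := by
  refine le_inf ?_ (le_generateFrom ?_)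
  · let := hornTopology (S := S) T φ
    refine continuous_iff_le_induced.1 (Continuous.subtype_mk (continuous_generateFrom_iff.2 ?_) _)
    rintro _ (⟨a, rfl⟩ | ⟨k, χ, hχ, a, rfl⟩)
    · exact isOpen_hornTopology_membSet a
    · exact isOpen_hornTopology_fSet hχ.isHorn a
  · rintro _ ⟨a, rfl⟩
    exact isOpen_hornTopology_secImage a

end HornTopology

section Reindexing

variable {L : FirstOrder.Language.{u, v}} {S : Type w}

/-- Since `S` is infinite, any finitely many elements of an indexed structure can be given
prescribed distinct indices, up to isomorphism. -/
theorem exists_reindexing [Infinite S] (N : IndexedStructure L S) (F : Finset S)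
    (w : F → N.carrier) :
    ∃ (G : IndexedIso L S) (hG : G.dom = N) (h : ∀ s : F, s.1 ∈ G.cod.A),
      ∀ s : F, G.map (cast (congrArg IndexedStructure.carrier hG.symm) (w s)) =
        G.cod.cls s.1 (h s) := by
  classical
  obtain ⟨e⟩ : Nonempty (((F : Set S)ᶜ : Set S) ≃ S) :=
    Cardinal.eq.1 (Cardinal.mk_compl_finset_of_infinite F)
  let A : Set S := {s | ∀ h : s ∉ F, e ⟨s, h⟩ ∈ N.A}
  let f : A → N.carrier := fun s =>
    if h : s.1 ∈ F then w ⟨s, h⟩ else N.cls (e ⟨s, h⟩) (s.2 h)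
  have hf : Function.Surjective f := by
    intro x
    obtain ⟨⟨a, ha⟩, rfl⟩ := Quotient.exists_rep x
    have hmem : (e.symm a).1 ∉ F := (e.symm a).2
    have he : e ⟨(e.symm a).1, hmem⟩ = a := e.apply_symm_apply a
    refine ⟨⟨(e.symm a).1, fun h => he.symm ▸ ha⟩, ?_⟩
    simp only [f, dif_neg hmem, he]
    rfl
  have hFA : ∀ s : F, s.1 ∈ A := fun s h => absurd s.2 h
  let E : N.carrier ≃ Quotient (Setoid.ker f) := (Setoid.quotientKerEquivOfSurjective f hf).symm
  let := N.str
  refine ⟨⟨N, ⟨A, Setoid.ker f, E.inducedStructure⟩, E.inducedStructureEquiv⟩, rfl, hFA,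
    fun s => ?_⟩
  change E (w s) = Quotient.mk (Setoid.ker f) ⟨s.1, hFA s⟩
  rw [← Equiv.eq_symm_apply]
  change w s = f ⟨s.1, hFA s⟩
  simp [f]

theorem IndexedIso.models_cod (G : IndexedIso L S) {T : Set L.Sentence} (h : G.dom.models T) :
    G.cod.models T := by
  let := G.dom.str
  let := G.cod.str
  exact fun σ hσ => (StrongHomClass.realize_sentence G.iso σ).1 (h σ hσ)

theorem IndexedIso.inv_map_map (G : IndexedIso L S) (x : G.dom.carrier) :
    G.inv.map (G.map x) = x :=
  (@Language.Equiv.toEquiv L G.dom.carrier G.cod.carrier G.dom.str G.cod.str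
    G.iso).symm_apply_apply x

variable {T : Set L.Sentence} {n : ℕ} {φ : L.Formula (Fin n)}

/-- The image of a point of `D_φ` under an isomorphism out of its first component. -/
def DSet.transport (d : DSet L S T φ) (G : IndexedIso L S) (hG : G.dom = d.str) :
    DSet L S T φ :=
  act ⟨(⟨G, hG.symm ▸ d.mods, G.models_cod (hG.symm ▸ d.mods)⟩, d), hG⟩

theorem Stable.of_transport_mem {U : Set (DSet L S T φ)} (hU : Stable U) {d : DSet L S T φ}
    {G : IndexedIso L S} {hG : G.dom = d.str} (h : d.transport G hG ∈ U) : d ∈ U := by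
  obtain ⟨M, hM, m, hm⟩ := d
  revert hG
  change ∀ hG : G.dom = M, DSet.transport ⟨M, hM, m, hm⟩ G hG ∈ U → _
  rintro rfl h
  have hact := hU ⟨(⟨G.inv, G.models_cod hM, hM⟩, _), rfl⟩ h
  have hact' : (⟨G.dom, hM, fun i => G.inv.map (G.map (m i)), by simpa only [G.inv_map_map]⟩ :
      DSet L S T φ) ∈ U := hact
  simpa only [G.inv_map_map] using hact'

end Reindexing

section MainResult

variable {L : FirstOrder.Language.{u, v}} {S : Type w} {T : Set L.Sentence} {n : ℕ}
  {φ : L.Formula (Fin n)}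

theorem exists_transport_mem_paramBasic [Infinite S] {F : Finset S} {ψ : L.Formula (Fin n ⊕ F)}
    (d : DSet L S T φ) (w : F → d.str.carrier) (hw : d.str.Sat ψ (Sum.elim d.tup w)) :
    ∃ (G : IndexedIso L S) (hG : G.dom = d.str), d.transport G hG ∈ paramBasic T φ F ψ := by
  obtain ⟨M, hM, m, hm⟩ := d
  obtain ⟨G, rfl, h, hGw⟩ := exists_reindexing M F w
  refine ⟨G, rfl, h, ?_⟩
  have hcomp : (fun i => G.map (Sum.elim m w i)) =
      Sum.elim (fun i => G.map (m i)) fun s => G.cod.cls s.1 (h s) := by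
    funext i
    rcases i with i | s
    · rfl
    · exact hGw s
  have hsat := G.sat_map ψ _ hw
  rw [hcomp] at hsat
  exact hsat

/-- Every open stable set contains, around each of its points, a set defined by an existentially
quantified Horn formula. -/
theorem exists_exSet_subset [Infinite S] {U : Set (DSet L S T φ)} (hopen : IsOpen U)
    (hstable : Stable U) {d : DSet L S T φ} (hd : d ∈ U) :
    ∃ (m : ℕ) (ψ : L.Formula (Fin n ⊕ Fin m)),
      IsHorn ψ ∧ d ∈ exSet φ ψ ∧ exSet φ ψ ⊆ U := by
  obtain ⟨F, ψ, hψ, ⟨h, hdψ⟩, hFU⟩ := hornTopology_le U hopen d hd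
  let g := F.equivFin
  refine ⟨F.card, ψ.relabel (Sum.map id g), hψ.formula_relabel _,
    ⟨(fun s : F => d.str.cls s.1 (h s)) ∘ g.symm, ?_⟩, ?_⟩
  · rw [sat_relabel, Sum.elim_comp_map, Function.comp_assoc, g.symm_comp_self]
    exact hdψ
  · rintro e ⟨w, hw⟩
    rw [sat_relabel, Sum.elim_comp_map] at hw
    obtain ⟨G, hG, hmem⟩ := exists_transport_mem_paramBasic e (w ∘ g) hw
    exact hstable.of_transport_mem (hFU hmem)

end MainResult

variable {L : FirstOrder.Language.{u, v}} {S : Type w}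

theorem stmt15 [Infinite S] (T : Set L.Sentence) {n : ℕ} (φ : L.Formula (Fin n))
    (U : Set (DSet L S T φ)) (hopen : IsOpen U) (hstable : Stable U) :
    ∃ 𝒮 : Set (Set (DSet L S T φ)),
      (∀ V ∈ 𝒮, ∃ (m : ℕ) (ψ : L.Formula (Fin n ⊕ Fin m)), IsHorn ψ ∧ V = exSet φ ψ) ∧
      U = ⋃₀ 𝒮 := by
  refine ⟨{V | V ⊆ U ∧ ∃ (m : ℕ) (ψ : L.Formula (Fin n ⊕ Fin m)), IsHorn ψ ∧ V = exSet φ ψ},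
    fun V hV => hV.2, Subset.antisymm (fun d hd => ?_) (sUnion_subset fun V hV => hV.1)⟩
  obtain ⟨m, ψ, hψ, hdψ, hψU⟩ := exists_exSet_subset hopen hstable hd
  exact ⟨exSet φ ψ, ⟨hψU, m, ψ, hψ, rfl⟩, hdψ⟩

end SemGpd
end

section
/- Assume S is infinite. Let T be a set of L-sentences, φ an L-formula with free variables among x₁,…,xₙ, and a an n-tuple of pairwise distinct elements of S. Then the stabilization under the action θ of the image s_a(⟨φ,a⟩ ∩ M_T) is all of D_φ. -/
open FirstOrder Language Set Topology TopologicalSpace Cardinal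

universe u v w

namespace SemGpd

variable (L : FirstOrder.Language.{u, v}) (S : Type w)

variable {L S}

variable (L S)

variable {L S}

variable (L S)

variable {L S}

variable (L S)

variable {L S}

variable (L S)

variable {L S}

variable (L S)

variable {L S}

variable {L : FirstOrder.Language.{u, v}} {S : Type w}

/-- A surjection from a subset of `S` onto the carrier of `M` presents an indexed structure
isomorphic to `M`. -/
noncomputable def IndexedStructure.reindex (M : IndexedStructure L S) {B : Set S}
    (g : B → M.carrier) (hg : Function.Surjective g) : IndexedStructure L S where
  A := B
  r := Setoid.ker g
  str :=
    letI := M.str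
    (Setoid.quotientKerEquivOfSurjective g hg).symm.inducedStructure

/-- The canonical isomorphism from a reindexed structure to the original one. -/
noncomputable def IndexedStructure.reindexIso (M : IndexedStructure L S) {B : Set S}
    (g : B → M.carrier) (hg : Function.Surjective g) : IndexedIso L S where
  dom := M.reindex g hg
  cod := M
  iso := by
    letI := M.str
    letI : L.Structure (Quotient (Setoid.ker g)) := (M.reindex g hg).str
    exact (Setoid.quotientKerEquivOfSurjective g hg).symm.inducedStructureEquiv.symm

theorem IndexedStructure.reindexIso_map_cls (M : IndexedStructure L S) {B : Set S}
    (g : B → M.carrier) (hg : Function.Surjective g) (b : S) (hb : b ∈ B) :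
    (M.reindexIso g hg).map ((M.reindex g hg).cls b hb) = g ⟨b, hb⟩ :=
  rfl

theorem IndexedIso.models_dom (F : IndexedIso L S) {T : Set L.Sentence} (h : F.cod.models T) :
    F.dom.models T := by
  let := F.dom.str
  let := F.cod.str
  intro σ hσ
  exact (StrongHomClass.realize_sentence F.iso σ).mpr (h σ hσ)

theorem IndexedIso.sat_of_sat_map (F : IndexedIso L S) {α : Type*} (φ : L.Formula α)
    (v : α → F.dom.carrier) (h : F.cod.Sat φ fun i => F.map (v i)) : F.dom.Sat φ v := by
  let := F.dom.str
  let := F.cod.str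
  exact (StrongHomClass.realize_formula F.iso φ (v := v)).mp h

/-- If `S` is infinite, every tuple of elements of an indexed structure is named by any prescribed
injective tuple of elements of `S` under some partial surjection from `S`. -/
theorem IndexedStructure.exists_surjective_extending [Infinite S] (M : IndexedStructure L S)
    {n : ℕ} (a : Fin n → S) (ha : Function.Injective a) (m : Fin n → M.carrier) :
    ∃ (B : Set S) (g : B → M.carrier) (h : ∀ i, a i ∈ B),
      Function.Surjective g ∧ ∀ i, g ⟨a i, h i⟩ = m i := by
  have hcard : #((range a)ᶜ : Set S) = #S :=
    mk_compl_of_infinite _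
      ((lt_aleph0_iff_set_finite.mpr (finite_range a)).trans_le (aleph0_le_mk S))
  obtain ⟨e⟩ := Cardinal.eq.mp hcard
  let j : M.carrier → S := fun x => (e.symm x.out : S)
  have hj : Function.Injective j := fun x y hxy =>
    Quotient.out_injective (Subtype.val_injective (e.symm.injective (Subtype.val_injective hxy)))
  have hf : Function.Injective (Sum.elim a j) :=
    ha.sumElim hj fun i x h => (e.symm x.out).2 ⟨i, h⟩
  refine ⟨range (Sum.elim a j), Sum.elim m id ∘ (Equiv.ofInjective _ hf).symm,
    fun i => ⟨Sum.inl i, rfl⟩, ?_, fun i => ?_⟩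
  · exact Function.Surjective.comp (fun x => ⟨Sum.inr x, rfl⟩) (Equiv.surjective _)
  · exact congrArg (Sum.elim m id) (Equiv.ofInjective_symm_apply hf (Sum.inl i))

theorem stmt16 [Infinite S] (T : Set L.Sentence) {n : ℕ} (φ : L.Formula (Fin n))
    (a : Fin n → S) (ha : Function.Injective a) :
    stabilization (secImage L S T φ a) = Set.univ := by
  refine eq_univ_of_forall fun ⟨M, hM, m, hm⟩ Y ⟨hXY, hY⟩ => ?_
  obtain ⟨B, g, hB, hg, hgm⟩ := M.exists_surjective_extending a ha m
  let F := M.reindexIso g hg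
  have hF : F.dom.models T := F.models_dom hM
  let b : Fin n → F.dom.carrier := fun i => (M.reindex g hg).cls (a i) (hB i)
  have hb : (fun i => F.map (b i)) = m :=
    funext fun i => (M.reindexIso_map_cls g hg (a i) (hB i)).trans (hgm i)
  have hsat : F.dom.Sat φ b := F.sat_of_sat_map φ b (hb.symm ▸ hm)
  have hmem := hY ⟨(⟨F, hF, hM⟩, ⟨F.dom, hF, b, hsat⟩), rfl⟩ (hXY ⟨hB, rfl⟩)
  subst hb
  exact hmem

end SemGpd
end
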